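/- Fix a field F and k ≥ 1, and let Δ be a finite abstract simplicial complex with no missing faces of dimension > k. Then the following are equivalent: (1) Δ is resolution i-chordal over F for every i with k ≤ i ≤ 2k−1; (2) Δ is resolution i-chordal over F for every i ≥ k; (3) Δ is k-Leray over F, i.e., H̃_j(Δ|V; F) = 0 for every j ≥ k and every vertex subset V. -/

import Mathlib

/-!
Basic notions for homological chordality of simplicial complexes,
following Adiprasito–Nevo–Samper, "Higher chordality: From graphs to complexes".

A finite abstract simplicial complex is modelled as a downward-closed finite
family of finite subsets of a vertex type `V`.  Chains of dimension `k` (with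
coefficients in a commutative ring `R`) are functions `Finset V → R` supported
on faces of cardinality `k + 1`; the simplicial boundary operator includes the
augmentation (so `0`-cycles are *reduced* cycles), matching the paper's
convention that `C₋₁` is generated by the empty face.
-/

open Finset

attribute [local instance] Classical.propDecidable

noncomputable section

/-- A finite abstract simplicial complex with vertices in `V`:
a downward-closed finite family of finite subsets of `V`. -/
structure ASC (V : Type*) where
  faces : Finset (Finset V)
  down_closed : ∀ ⦃s t : Finset V⦄, s ∈ faces → t ⊆ s → t ∈ faces

variable {V : Type*} [Fintype V] [LinearOrder V]

/-- `(-1)` to the number of elements of `t` smaller than `v`; this is the sign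
of the position of `v` in the ordered set `insert v t`. -/
def esign (v : V) (t : Finset V) : ℤ :=
  (-1) ^ (t.filter fun w => w < v).card

/-- The simplicial boundary operator (including the augmentation at the empty
face): `(bdry c) t = ∑_{v ∉ t} ± c (insert v t)`. -/
def bdry {R : Type*} [CommRing R] (c : Finset V → R) : Finset V → R :=
  fun t => ∑ v ∈ tᶜ, esign v t • c (insert v t)

/-- `c` is a chain of dimension `k` on the set of faces `S`:
it is supported on members of `S` of cardinality `k + 1`. -/
def IsChainOn {R : Type*} [CommRing R] (S : Set (Finset V)) (k : ℤ)
    (c : Finset V → R) : Prop :=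
  ∀ s : Finset V, c s ≠ 0 → s ∈ S ∧ (s.card : ℤ) = k + 1

/-- The vertex support `c⁰` of a chain: all vertices lying in a face with a
nonzero coefficient. -/
def vsupp {R : Type*} [CommRing R] (c : Finset V → R) : Set V :=
  {v | ∃ s : Finset V, c s ≠ 0 ∧ v ∈ s}

/-- Vanishing of the `k`-th (reduced) homology of the family of faces `S` over `R`:
every `k`-cycle is the boundary of a `(k+1)`-chain. -/
def HVanish (R : Type*) [CommRing R] (S : Set (Finset V)) (k : ℤ) : Prop :=
  ∀ z : Finset V → R, IsChainOn S k z → bdry z = 0 →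
    ∃ c : Finset V → R, IsChainOn S (k + 1) c ∧ bdry c = z

/-- `Δ` is resolution `k`-chordal over `R`: every `k`-cycle `z` of `Δ` admits a
resolution, i.e. a `(k+1)`-chain `c` of `Δ` with `∂c = z` and the same vertex
support as `z`. -/
def ResChordal (R : Type*) [CommRing R] (Δ : ASC V) (k : ℤ) : Prop :=
  ∀ z : Finset V → R, IsChainOn (↑Δ.faces) k z → bdry z = 0 →
    ∃ c : Finset V → R, IsChainOn (↑Δ.faces) (k + 1) c ∧ bdry c = z ∧ vsupp c = vsupp z

/-- `z` is a complete `k`-cycle on the face set `S`: it is a `k`-cycle whose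
faces with nonzero coefficient are precisely all the `k`-dimensional faces of
some set `W` of `k + 2` vertices, and all those faces belong to `S`. -/
def IsCompleteCycleOn {R : Type*} [CommRing R] (S : Set (Finset V)) (k : ℤ)
    (z : Finset V → R) : Prop :=
  bdry z = 0 ∧ ∃ W : Finset V, (W.card : ℤ) = k + 2 ∧
    (∀ s : Finset V, z s ≠ 0 ↔ s ⊆ W ∧ (s.card : ℤ) = k + 1) ∧
    ∀ s : Finset V, s ⊆ W → (s.card : ℤ) = k + 1 → s ∈ S

/-- `Δ` is decomposition `k`-chordal over `R`: every `k`-cycle `z` of `Δ` is a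
sum of complete `k`-cycles of `Δ` supporting only vertices supported in `z`. -/
def DecChordal (R : Type*) [CommRing R] (Δ : ASC V) (k : ℤ) : Prop :=
  ∀ z : Finset V → R, IsChainOn (↑Δ.faces) k z → bdry z = 0 →
    ∃ (n : ℕ) (zs : Fin n → Finset V → R),
      z = ∑ i, zs i ∧
      ∀ i, IsCompleteCycleOn (↑Δ.faces) k (zs i) ∧ vsupp (zs i) ⊆ vsupp z

/-- `σ` is a missing face (minimal nonface) of `Δ`: `σ` is not a face but all
its proper subsets are.  Its dimension is `σ.card - 1`. -/
def IsMissingFace (Δ : ASC V) (σ : Finset V) : Prop :=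
  σ ∉ Δ.faces ∧ ∀ t ⊂ σ, t ∈ Δ.faces

/-- The induced subcomplex `Δ|W` on a subset `W` of the vertices. -/
def induced (Δ : ASC V) (W : Finset V) : ASC V where
  faces := Δ.faces.filter fun s => s ⊆ W
  down_closed := by
    intro s t hs hts
    simp only [mem_filter] at hs ⊢
    exact ⟨Δ.down_closed hs.1 hts, hts.trans hs.2⟩

/-- `Δ` is `k`-Leray over `R`: the reduced homology `H̃ⱼ(Δ|W; R)` vanishes for
every `j ≥ k` and every vertex subset `W`. -/
def IsLeray (R : Type*) [CommRing R] (Δ : ASC V) (k : ℤ) : Prop :=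
  ∀ (W : Finset V) (j : ℤ), k ≤ j → HVanish R (((induced Δ W).faces : Set (Finset V))) j

/-- The closed star `St_σ Δ = ∪_{σ ⊆ τ ∈ Δ} 2^τ`. -/
def star (Δ : ASC V) (σ : Finset V) : ASC V where
  faces := Δ.faces.filter fun s => ∃ τ ∈ Δ.faces, σ ⊆ τ ∧ s ⊆ τ
  down_closed := by
    intro s t hs hts
    simp only [mem_filter] at hs ⊢
    obtain ⟨h1, τ', h2, h3, h4⟩ := hs
    exact ⟨Δ.down_closed h1 hts, τ', h2, h3, hts.trans h4⟩

/-- The deletion `Δ - σ`: the maximal subcomplex of `Δ` not containing `σ`. -/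
def del (Δ : ASC V) (σ : Finset V) : ASC V where
  faces := Δ.faces.filter fun s => ¬ σ ⊆ s
  down_closed := by
    intro s t hs hts
    simp only [mem_filter] at hs ⊢
    exact ⟨Δ.down_closed hs.1 hts, fun h => hs.2 (h.trans hts)⟩

/-- The extended link `eLk_σ Δ = St_σ Δ - σ`. -/
def eLk (Δ : ASC V) (σ : Finset V) : ASC V := del (star Δ σ) σ

/-- The link `Lk_σ Δ = {τ \ σ : σ ⊆ τ ∈ Δ}`. -/
def link (Δ : ASC V) (σ : Finset V) : ASC V where
  faces := Finset.univ.filter fun t => Disjoint σ t ∧ σ ∪ t ∈ Δ.faces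
  down_closed := by
    intro s t hs hts
    simp only [mem_filter, mem_univ, true_and] at hs ⊢
    exact ⟨hs.1.mono_right hts, Δ.down_closed hs.2 (union_subset_union_right hts)⟩

/-- The `k`-clique complex `Cl_k Δ`: faces are the sets of vertices of `Δ` all
of whose subsets of cardinality at most `k + 1` are faces of `Δ`. -/
def clique (Δ : ASC V) (k : ℤ) : ASC V where
  faces := Finset.univ.filter fun s =>
    (∀ v ∈ s, {v} ∈ Δ.faces) ∧ ∀ t ⊆ s, (t.card : ℤ) ≤ k + 1 → t ∈ Δ.faces
  down_closed := by
    intro s t hs hts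
    simp only [mem_filter, mem_univ, true_and] at hs ⊢
    exact ⟨fun v hv => hs.1 v (hts hv), fun u hu hc => hs.2 u (hu.trans hts) hc⟩

/-- The vertex set of a complex, as a set of elements of `V`. -/
def vertexSet (Δ : ASC V) : Set V := {v | {v} ∈ Δ.faces}

/-- The relative simplicial complex `(Δ, Γ)` is resolution `k`-chordal over `R`:
every relative `k`-cycle (a `k`-chain of `Δ` supported off `Γ` whose boundary
is a chain of `Γ`) admits a resolution, i.e. a `(k+1)`-chain `c` of `Δ`
supported off `Γ` with `∂c ≡ z` modulo chains of `Γ` and `vsupp c = vsupp z`. -/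
def RelResChordal (R : Type*) [CommRing R] (Δ Γ : ASC V) (k : ℤ) : Prop :=
  ∀ z : Finset V → R, IsChainOn (↑Δ.faces) k z → (∀ s, z s ≠ 0 → s ∉ Γ.faces) →
    IsChainOn (↑Γ.faces) (k - 1) (bdry z) →
    ∃ c : Finset V → R, IsChainOn (↑Δ.faces) (k + 1) c ∧ (∀ s, c s ≠ 0 → s ∉ Γ.faces) ∧
      IsChainOn (↑Γ.faces) k (bdry c - z) ∧ vsupp c = vsupp z

/-- The union of two simplicial complexes (taken facewise). -/
def aunion (Δ Γ : ASC V) : ASC V where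
  faces := Δ.faces ∪ Γ.faces
  down_closed := by
    intro s t hs hts
    rcases Finset.mem_union.1 hs with h | h
    · exact Finset.mem_union.2 (Or.inl (Δ.down_closed h hts))
    · exact Finset.mem_union.2 (Or.inr (Γ.down_closed h hts))

/-- The intersection of two simplicial complexes (taken facewise). -/
def ainter (Δ Γ : ASC V) : ASC V where
  faces := Δ.faces ∩ Γ.faces
  down_closed := by
    intro s t hs hts
    rw [Finset.mem_inter] at hs ⊢
    exact ⟨Δ.down_closed hs.1 hts, Γ.down_closed hs.2 hts⟩

/-- The `k`-skeleton of `Δ`: all faces of dimension at most `k`. -/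
def skel (Δ : ASC V) (k : ℤ) : ASC V where
  faces := Δ.faces.filter fun s => (s.card : ℤ) ≤ k + 1
  down_closed := by
    intro s t hs hts
    simp only [mem_filter] at hs ⊢
    refine ⟨Δ.down_closed hs.1 hts, le_trans ?_ hs.2⟩
    exact_mod_cast Finset.card_le_card hts

set_option linter.unusedSectionVars false

section ChainComplex

variable {R : Type*} [CommRing R]

theorem bdry_add (c d : Finset V → R) : bdry (c + d) = bdry c + bdry d := by
  funext t
  simp [bdry, smul_add, sum_add_distrib]

theorem bdry_sub (c d : Finset V → R) : bdry (c - d) = bdry c - bdry d := by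
  funext t
  simp [bdry, smul_sub, sum_sub_distrib]

theorem esign_insert_of_lt {v w : V} {t : Finset V} (hv : v ∉ t) (h : v < w) :
    esign w (insert v t) = -esign w t := by
  unfold esign
  rw [filter_insert, if_pos h, card_insert_of_notMem (by simp [hv]), pow_succ]
  ring

theorem esign_insert_of_gt {v w : V} {t : Finset V} (h : w < v) :
    esign w (insert v t) = esign w t := by
  unfold esign
  rw [filter_insert, if_neg h.not_gt]

/-- Adding two vertices in the opposite order changes the total sign. -/
theorem esign_mul_esign_insert {v w : V} {t : Finset V} (hv : v ∉ t) (hw : w ∉ t) (h : v ≠ w) :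
    esign v t * esign w (insert v t) = -(esign w t * esign v (insert w t)) := by
  rcases lt_or_gt_of_ne h with h | h
  · rw [esign_insert_of_lt hv h, esign_insert_of_gt h]
    ring
  · rw [esign_insert_of_lt hw h, esign_insert_of_gt h]
    ring

theorem bdry_bdry (c : Finset V → R) : bdry (bdry c) = 0 := by
  funext t
  simp only [bdry, smul_sum, Pi.zero_apply, smul_smul]
  rw [sum_sigma']
  refine sum_involution (fun p _ => ⟨p.2, p.1⟩) ?_ ?_ ?_ ?_
  · rintro ⟨v, w⟩ h
    simp only [mem_sigma, mem_compl, mem_insert, not_or] at h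
    rw [esign_mul_esign_insert h.1 h.2.2 (Ne.symm h.2.1), insert_comm, neg_smul, neg_add_cancel]
  · rintro ⟨v, w⟩ h _ heq
    simp only [mem_sigma, mem_compl, mem_insert, not_or] at h
    exact h.2.1 (congrArg Sigma.fst heq)
  · rintro ⟨v, w⟩ h
    simp only [mem_sigma, mem_compl, mem_insert, not_or] at h ⊢
    exact ⟨h.2.2, Ne.symm h.2.1, h.1⟩
  · rintro ⟨v, w⟩ _
    rfl

variable {A B : Set (Finset V)} {i : ℤ} {c d : Finset V → R}

theorem IsChainOn.add (hc : IsChainOn A i c) (hd : IsChainOn A i d) : IsChainOn A i (c + d) := by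
  intro s hs
  by_cases h : c s = 0
  · exact hd s fun h' => hs (by simp [h, h'])
  · exact hc s h

theorem IsChainOn.neg (hc : IsChainOn A i c) : IsChainOn A i (-c) :=
  fun s hs => hc s fun h => hs (by simp [h])

theorem IsChainOn.sub (hc : IsChainOn A i c) (hd : IsChainOn A i d) : IsChainOn A i (c - d) := by
  rw [sub_eq_add_neg]
  exact hc.add hd.neg

theorem IsChainOn.mono (hc : IsChainOn A i c) (h : A ⊆ B) : IsChainOn B i c :=
  fun s hs => ⟨h (hc s hs).1, (hc s hs).2⟩

theorem IsChainOn.inter (hA : IsChainOn A i c) (hB : IsChainOn B i c) : IsChainOn (A ∩ B) i c :=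
  fun s hs => ⟨⟨(hA s hs).1, (hB s hs).1⟩, (hA s hs).2⟩

theorem exists_insert_of_bdry_ne_zero {t : Finset V} (h : bdry c t ≠ 0) :
    ∃ v ∉ t, c (insert v t) ≠ 0 := by
  obtain ⟨v, hv, hne⟩ := exists_ne_zero_of_sum_ne_zero h
  exact ⟨v, mem_compl.1 hv, fun h0 => hne (by rw [h0, smul_zero])⟩

theorem IsChainOn.bdry (hA : IsLowerSet A) (hc : IsChainOn A i c) :
    IsChainOn A (i - 1) (bdry c) := by
  intro t ht
  obtain ⟨v, hv, hne⟩ := exists_insert_of_bdry_ne_zero ht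
  obtain ⟨h1, h2⟩ := hc _ hne
  refine ⟨hA (subset_insert v t) h1, ?_⟩
  rw [card_insert_of_notMem hv] at h2
  push_cast at h2
  linarith

theorem vsupp_bdry_subset (c : Finset V → R) : vsupp (bdry c) ⊆ vsupp c := by
  rintro x ⟨t, ht, hx⟩
  obtain ⟨v, _, hne⟩ := exists_insert_of_bdry_ne_zero ht
  exact ⟨_, hne, mem_insert_of_mem hx⟩

/-- Vanishing part of the Mayer–Vietoris sequence. -/
theorem HVanish.union (hA : IsLowerSet A) (hB : IsLowerSet B) (hvA : HVanish R A i)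
    (hvB : HVanish R B i) (hvAB : HVanish R (A ∩ B) (i - 1)) : HVanish R (A ∪ B) i := by
  intro z hz hz0
  let a : Finset V → R := fun s => if s ∈ A then z s else 0
  have ha : IsChainOn A i a := by
    intro s hs
    by_cases h : s ∈ A
    · exact ⟨h, (hz s (by simpa [a, h] using hs)).2⟩
    · simp [a, h] at hs
  have hb : IsChainOn B i (z - a) := by
    intro s hs
    by_cases h : s ∈ A
    · simp [a, h] at hs
    · obtain ⟨h1, h2⟩ := hz s (by simpa [a, h] using hs)
      exact ⟨h1.resolve_left h, h2⟩
  have hab : bdry (z - a) = -bdry a := by rw [bdry_sub, hz0, zero_sub]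
  obtain ⟨w, hw, hwb⟩ := hvAB (bdry a)
    ((ha.bdry hA).inter (by simpa [hab] using (hb.bdry hB).neg)) (bdry_bdry a)
  rw [sub_add_cancel] at hw
  obtain ⟨p, hp, hpb⟩ := hvA (a - w) (ha.sub (hw.mono Set.inter_subset_left))
    (by rw [bdry_sub, hwb, sub_self])
  obtain ⟨q, hq, hqb⟩ := hvB (z - a + w) (hb.add (hw.mono Set.inter_subset_right))
    (by rw [bdry_add, hab, hwb, neg_add_cancel])
  refine ⟨p + q, (hp.mono Set.subset_union_left).add (hq.mono Set.subset_union_right), ?_⟩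
  rw [bdry_add, hpb, hqb]
  abel

/-- If `T` is contained in no face of `A`, then `A` is covered by the deletions of the vertices
of `T`; this is the resulting homology vanishing criterion. -/
theorem HVanish.of_cover (T : Finset V) (hA : IsLowerSet A)
    (h : ∀ U ⊆ T, U.Nonempty → HVanish R {s ∈ A | Disjoint s U} (i - U.card + 1)) :
    HVanish R {s ∈ A | ¬ T ⊆ s} i := by
  induction T using Finset.induction_on generalizing A i with
  | empty =>
    intro z hz _
    have hz0 : z = 0 := by
      funext s
      by_contra hs
      exact (hz s hs).1.2 (empty_subset s)
    exact ⟨0, fun s hs => absurd rfl hs, by rw [hz0]; funext t; simp [bdry]⟩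
  | insert v T hv ih =>
    have hdisj : ∀ U : Finset V, IsLowerSet {s ∈ A | Disjoint s U} := fun U s t hts hs =>
      ⟨hA hts hs.1, hs.2.mono_left hts⟩
    have hmiss : IsLowerSet {s ∈ A | ¬ T ⊆ s} := fun s t hts hs =>
      ⟨hA hts hs.1, fun hT => hs.2 (hT.trans hts)⟩
    have hunion : {s ∈ A | ¬ insert v T ⊆ s} =
        {s ∈ A | Disjoint s {v}} ∪ {s ∈ A | ¬ T ⊆ s} := by
      ext s
      simp only [insert_subset_iff, disjoint_singleton_right, Set.mem_ofPred_eq, Set.mem_union]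
      tauto
    have hinter : {s ∈ A | Disjoint s {v}} ∩ {s ∈ A | ¬ T ⊆ s} =
        {s ∈ {s ∈ A | Disjoint s {v}} | ¬ T ⊆ s} := by
      ext s
      simp only [Set.mem_ofPred_eq, Set.mem_inter_iff]
      tauto
    rw [hunion]
    refine HVanish.union (hdisj _) hmiss ?_ ?_ ?_
    · simpa using h {v} (by simp) (singleton_nonempty v)
    · exact ih hA fun U hU hne => h U (hU.trans (subset_insert v T)) hne
    · rw [hinter]
      refine ih (hdisj _) fun U hU hne => ?_
      have hvU : v ∉ U := fun h' => hv (hU h')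
      have hset : {s ∈ {s ∈ A | Disjoint s {v}} | Disjoint s U} =
          {s ∈ A | Disjoint s (insert v U)} := by
        ext s
        simp only [disjoint_insert_right, disjoint_singleton_right, Set.mem_ofPred_eq]
        tauto
      have := h (insert v U) (insert_subset_insert v hU) (insert_nonempty v U)
      rw [card_insert_of_notMem hvU] at this
      push_cast at this
      rw [hset]
      convert this using 1
      ring

/-- A nonempty simplex has vanishing reduced homology. -/
theorem hvanish_simplex {W : Finset V} (hW : W.Nonempty) (i : ℤ) :
    HVanish R {s : Finset V | s ⊆ W} i := by
  intro z hz hz0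
  set m := W.min' hW
  have hmW : m ∈ W := W.min'_mem hW
  have hsign : ∀ s ⊆ W, esign m s = 1 := by
    intro s hs
    have : s.filter (fun w => w < m) = ∅ :=
      filter_eq_empty_iff.2 fun x hx => (W.min'_le x (hs hx)).not_gt
    simp [esign, this]
  let c : Finset V → R := fun s => if m ∈ s then z (s.erase m) else 0
  have hzm : ∀ s, z s ≠ 0 → s ⊆ W := fun s hs => (hz s hs).1
  refine ⟨c, ?_, ?_⟩
  · intro s hs
    by_cases hm : m ∈ s
    · obtain ⟨h1, h2⟩ := hz (s.erase m) (by simpa [c, hm] using hs)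
      refine ⟨?_, ?_⟩
      · rw [← insert_erase hm]
        exact insert_subset hmW h1
      · rw [← card_erase_add_one hm]
        push_cast
        rw [h2]
    · simp [c, hm] at hs
  · funext t
    by_cases hm : m ∈ t
    · obtain ⟨u, hu, rfl⟩ : ∃ u, m ∉ u ∧ insert m u = t :=
        ⟨t.erase m, notMem_erase m t, insert_erase hm⟩
      have hb : bdry z u = 0 := congrFun hz0 u
      unfold bdry at hb ⊢
      have hcompl : (uᶜ : Finset V) = insert m (insert m u)ᶜ := by
        ext x
        by_cases hx : x = m <;> simp [hx, hu]
      rw [hcompl, sum_insert (by simp)] at hb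
      by_cases huW : u ⊆ W
      · rw [hsign u huW, one_smul] at hb
        rw [eq_neg_of_add_eq_zero_left hb, ← sum_neg_distrib]
        refine sum_congr rfl fun v hv => ?_
        simp only [mem_compl, mem_insert, not_or] at hv
        have hcv : c (insert v (insert m u)) = z (insert v u) := by
          simp only [c, mem_insert_self, mem_insert, or_true, if_true]
          rw [insert_comm, erase_insert (by simp [hu, Ne.symm hv.1])]
        rw [hcv]
        rcases eq_or_ne (z (insert v u)) 0 with hz' | hz'
        · rw [hz', smul_zero, smul_zero, neg_zero]
        · have hvW : v ∈ W := hzm _ hz' (mem_insert_self v u)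
          have hmv : m < v := lt_of_le_of_ne (W.min'_le v hvW) (Ne.symm hv.1)
          rw [esign_insert_of_lt hu hmv, neg_smul]
      · have h0 : ∀ x, z (insert x u) = 0 := fun x => by
          by_contra h
          exact huW ((subset_insert x u).trans (hzm _ h))
        rw [h0]
        refine sum_eq_zero fun v hv => ?_
        simp only [mem_compl, mem_insert, not_or] at hv
        have hcv : c (insert v (insert m u)) = z (insert v u) := by
          simp only [c, mem_insert_self, mem_insert, or_true, if_true]
          rw [insert_comm, erase_insert (by simp [hu, Ne.symm hv.1])]
        rw [hcv, h0, smul_zero]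
    · unfold bdry
      rw [sum_eq_single m]
      · have hcm : c (insert m t) = z t := by simp [c, hm]
        rw [hcm]
        by_cases hzt : z t = 0
        · simp [hzt]
        · rw [hsign t (hzm t hzt), one_smul]
      · intro v _ hvm
        have : c (insert v t) = 0 := by simp [c, hm, Ne.symm hvm]
        rw [this, smul_zero]
      · intro h
        exact absurd (mem_compl.2 hm) h

end ChainComplex

theorem exists_isMissingFace_subset (Δ : ASC V) {W : Finset V} (hW : W ∉ Δ.faces) :
    ∃ σ ⊆ W, IsMissingFace Δ σ := by
  obtain ⟨σ, hσW, hσ⟩ := exists_minimal_le_of_wellFoundedLT (fun s => s ∉ Δ.faces) W hW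
  refine ⟨σ, hσW, hσ.prop, fun t ht => ?_⟩
  by_contra h
  exact ht.2 (hσ.le_of_le h ht.1)

/-- Resolution `i`-chordality amounts to vanishing of the `i`-th homology of all induced
subcomplexes. -/
theorem resChordal_iff_hvanish_induced {R : Type*} [CommRing R] (Δ : ASC V) (i : ℤ) :
    ResChordal R Δ i ↔ ∀ W : Finset V, HVanish R ((induced Δ W).faces : Set (Finset V)) i := by
  constructor
  · intro h W z hz hz0
    obtain ⟨c, hc, hcb, hcs⟩ := h z (fun s hs => ⟨(mem_filter.1 (hz s hs).1).1, (hz s hs).2⟩) hz0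
    refine ⟨c, fun s hs => ⟨mem_filter.2 ⟨(hc s hs).1, fun x hx => ?_⟩, (hc s hs).2⟩, hcb⟩
    obtain ⟨t, ht, hxt⟩ : x ∈ vsupp z := hcs ▸ ⟨s, hs, hx⟩
    exact (mem_filter.1 (hz t ht).1).2 hxt
  · intro h z hz hz0
    obtain ⟨c, hc, hcb⟩ := h (univ.filter (· ∈ vsupp z)) z
      (fun s hs => ⟨mem_filter.2 ⟨(hz s hs).1, fun x hx =>
        mem_filter.2 ⟨mem_univ x, s, hs, hx⟩⟩, (hz s hs).2⟩) hz0
    refine ⟨c, fun s hs => ⟨(mem_filter.1 (hc s hs).1).1, (hc s hs).2⟩, hcb,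
      Set.Subset.antisymm ?_ (hcb ▸ vsupp_bdry_subset c)⟩
    rintro x ⟨s, hs, hx⟩
    exact (mem_filter.1 ((mem_filter.1 (hc s hs).1).2 hx)).2

theorem hvanish_induced_empty {R : Type*} [CommRing R] {i : ℤ} (hi : 0 ≤ i) (Δ : ASC V) :
    HVanish R ((induced Δ ∅).faces : Set (Finset V)) i := by
  intro z hz _
  refine ⟨0, fun s hs => absurd rfl hs, ?_⟩
  funext t
  by_contra ht
  obtain ⟨h1, h2⟩ := hz t fun h => ht (by simp [bdry, h])
  rw [subset_empty.1 (mem_filter.1 h1).2] at h2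
  simp at h2
  linarith

/-- For a complex without missing faces of dimension `> k`, vanishing of the homology of all induced
subcomplexes in degrees `k, …, 2 * k - 1` propagates to all degrees `≥ k`. -/
theorem isLeray_of_hvanish_induced {R : Type*} [CommRing R] {k : ℤ} (hk : 0 ≤ k) (Δ : ASC V)
    (hmissing : ∀ σ : Finset V, IsMissingFace Δ σ → (σ.card : ℤ) ≤ k + 1)
    (h : ∀ i : ℤ, k ≤ i → i ≤ 2 * k - 1 → ∀ W : Finset V,
      HVanish R ((induced Δ W).faces : Set (Finset V)) i) :
    IsLeray R Δ k := by
  intro W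
  induction W using Finset.strongInduction with
  | H W ih =>
    intro j hj
    by_cases hj2 : j ≤ 2 * k - 1
    · exact h j hj hj2 W
    by_cases hW : W ∈ Δ.faces
    · rcases W.eq_empty_or_nonempty with rfl | hne
      · exact hvanish_induced_empty (hk.trans hj) Δ
      · have hset : ((induced Δ W).faces : Set (Finset V)) = {s | s ⊆ W} := by
          ext s
          simpa [induced] using fun hs => Δ.down_closed hW hs
        rw [hset]
        exact hvanish_simplex hne j
    · obtain ⟨σ, hσW, hσ⟩ := exists_isMissingFace_subset Δ hW
      have hset : ((induced Δ W).faces : Set (Finset V)) =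
          {s ∈ ((induced Δ W).faces : Set (Finset V)) | ¬ σ ⊆ s} := by
        ext s
        refine ⟨fun hs => ⟨hs, fun hσs => ?_⟩, fun hs => hs.1⟩
        exact hσ.1 (Δ.down_closed (mem_filter.1 hs).1 hσs)
      rw [hset]
      refine HVanish.of_cover σ (fun s t hts hs => (induced Δ W).down_closed hs hts)
        fun U hU hne => ?_
      have hdel : {s ∈ ((induced Δ W).faces : Set (Finset V)) | Disjoint s U} =
          ((induced Δ (W \ U)).faces : Set (Finset V)) := by
        ext s
        simp [induced, subset_sdiff, and_assoc]
      rw [hdel]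
      have hcard : (U.card : ℤ) ≤ k + 1 :=
        le_trans (by exact_mod_cast card_le_card hU) (hmissing σ hσ)
      exact ih _ (sdiff_ssubset (hU.trans hσW) hne) _ (by linarith [not_le.1 hj2])

/-- Theorem 5.1 (equivalences (1) ⇔ (2) ⇔ (3)): for a complex with no missing
faces of dimension `> k` and a field `F`, resolution `i`-chordality for
`k ≤ i ≤ 2k - 1`, resolution `i`-chordality for all `i ≥ k`, and being
`k`-Leray over `F` are all equivalent. -/
theorem resChordal_propagation_tfae {V : Type*} [Fintype V] [LinearOrder V]
    (F : Type*) [Field F] (k : ℤ) (hk : 1 ≤ k) (Δ : ASC V)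
    (hmissing : ∀ σ : Finset V, IsMissingFace Δ σ → (σ.card : ℤ) ≤ k + 1) :
    ((∀ i : ℤ, k ≤ i → i ≤ 2 * k - 1 → ResChordal F Δ i) ↔
      (∀ i : ℤ, k ≤ i → ResChordal F Δ i)) ∧
    ((∀ i : ℤ, k ≤ i → i ≤ 2 * k - 1 → ResChordal F Δ i) ↔ IsLeray F Δ k) := by
  simp only [resChordal_iff_hvanish_induced]
  have hprop := isLeray_of_hvanish_induced (R := F) (by linarith : 0 ≤ k) Δ hmissing
  exact ⟨⟨fun h i hi W => hprop h W i hi, fun h i hi _ => h i hi⟩,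
    ⟨hprop, fun h i hi _ W => h W i hi⟩⟩
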